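/- Let (Λ_Q, f) be a C^{1+Lip} expansive and transitive Markov system. If f has no parabolic periodic points in Λ_Q, then f|Λ_Q is uniformly hyperbolic: there exist constants C > 0 and κ > 1 such that |(f^n)'(x)| ≥ C κ^n for every x ∈ Λ_Q and every n ≥ 1. -/

import Mathlib

open Set Metric Filter MeasureTheory
open scoped Classical

/-- The word `[ω 0, ω 1, …, ω (n-1)]` read off from the sequence `ω`. -/
def wordOf {p : ℕ} (ω : ℕ → Fin p) (n : ℕ) : List (Fin p) :=
  (List.range n).map ω

/-- The cylinder sets `Δ_{i₁…iₙ} = g_{i₁…i_{n-1}}(I_{iₙ})` of the iterated function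
system given by the big interval `I`, the subintervals `Isub i` and the maps `g i`;
by convention `Δ_∅ = I`. -/
def cylOf {p : ℕ} (I : Set ℝ) (Isub : Fin p → Set ℝ) (g : Fin p → ℝ → ℝ) :
    List (Fin p) → Set ℝ
  | [] => I
  | [i] => Isub i
  | i :: j :: w => g i '' cylOf I Isub g (j :: w)

/-- The sequence `ω` contains the word `w` as a sub-word starting at position `n`. -/
def containsAt {p : ℕ} (ω : ℕ → Fin p) (w : List (Fin p)) (n : ℕ) : Prop :=
  ∀ k : ℕ, (hk : k < w.length) → ω (n + k) = w.get ⟨k, hk⟩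

/-- The sequence `ω` belongs to `Σ_Q`, i.e. it contains no word of `Q` as a sub-word. -/
def avoids {p : ℕ} (Q : Finset (List (Fin p))) (ω : ℕ → Fin p) : Prop :=
  ∀ w ∈ Q, ∀ n : ℕ, ¬ containsAt ω w n

/-- The limit set `Λ_Q = π(Σ_Q)`: points lying, for some `ω ∈ Σ_Q`, in all the
cylinders `Δ_{ω₀…ω_{n-1}}`. -/
def limitSetOf {p : ℕ} (I : Set ℝ) (Isub : Fin p → Set ℝ) (g : Fin p → ℝ → ℝ)
    (Q : Finset (List (Fin p))) : Set ℝ :=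
  { x | ∃ ω : ℕ → Fin p, avoids Q ω ∧ ∀ n : ℕ, x ∈ cylOf I Isub g (wordOf ω n) }

/-- `gIter g ω n = g_{i_n … i_1} = g_{ω (n-1)} ∘ ⋯ ∘ g_{ω 0}`. -/
def gIter {p : ℕ} (g : Fin p → ℝ → ℝ) (ω : ℕ → Fin p) : ℕ → ℝ → ℝ
  | 0 => id
  | n + 1 => g (ω n) ∘ gIter g ω n

/-- The derivative of the composition `gIter g ω n` at `x` (chain rule product). -/
noncomputable def gIterDer {p : ℕ} (g gder : Fin p → ℝ → ℝ) (ω : ℕ → Fin p)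
    (n : ℕ) (x : ℝ) : ℝ :=
  ∏ k ∈ Finset.range n, gder (ω k) (gIter g ω k x)

/-- Prepending the finite word `w` to the infinite sequence `ω`. -/
def prependWord {p : ℕ} (w : List (Fin p)) (ω : ℕ → Fin p) : ℕ → Fin p :=
  fun n => if h : n < w.length then w.get ⟨n, h⟩ else ω (n - w.length)

/-- `l(Σ_Q)`: the minimum, over all finite sets `Q'` of words with `Σ_{Q'} = Σ_Q`,
of the maximal length `l(Q')` of words of `Q'`. -/
noncomputable def minRepLen {p : ℕ} (Q : Finset (List (Fin p))) : ℕ :=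
  sInf { n : ℕ | ∃ Q' : Finset (List (Fin p)),
    (∀ ω : ℕ → Fin p, avoids Q' ω ↔ avoids Q ω) ∧ Q'.sup List.length = n }

/-- A `C^{1+Lip}` expansive and transitive Markov system `(Λ_Q, f)`. -/
structure ExpansiveMarkovSystem (p : ℕ) where
  /-- the alphabet is nonempty -/
  hp : 0 < p
  /-- the ambient closed interval `I` -/
  I : Set ℝ
  hI : ∃ a b : ℝ, a < b ∧ I = Set.Icc a b
  /-- the pairwise disjoint closed subintervals `I₁, …, I_p` -/
  Isub : Fin p → Set ℝ
  hIsub : ∀ i, ∃ a b : ℝ, a < b ∧ Isub i = Set.Icc a b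
  hsubI : ∀ i, Isub i ⊆ I
  hdisj : ∀ i j, i ≠ j → Disjoint (Isub i) (Isub j)
  /-- the contractions `g i`, defined on `⋃ j, Isub j` -/
  g : Fin p → ℝ → ℝ
  /-- the derivative of `g i` on `⋃ j, Isub j` -/
  gder : Fin p → ℝ → ℝ
  hg_inj : ∀ i, Set.InjOn (g i) (⋃ j, Isub j)
  hg_range : ∀ i, g i '' (⋃ j, Isub j) ⊆ interior (Isub i)
  hg_deriv : ∀ i, ∀ x ∈ ⋃ j, Isub j,
    HasDerivWithinAt (g i) (gder i x) (⋃ j, Isub j) x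
  hgder_ne : ∀ i, ∀ x ∈ ⋃ j, Isub j, gder i x ≠ 0
  hgder_cont : ∀ i, ContinuousOn (gder i) (⋃ j, Isub j)
  /-- `log |g i'|` is Lipschitz on the domain -/
  hgder_lip : ∀ i, ∃ θ : ℝ, ∀ x ∈ ⋃ j, Isub j, ∀ y ∈ ⋃ j, Isub j,
    abs (Real.log (abs (gder i x)) - Real.log (abs (gder i y))) ≤ θ * |x - y|
  /-- the expanding map `f`, with `f (g i x) = x` -/
  f : ℝ → ℝ
  /-- the derivative `f'` of `f` on the ranges of the `g i` -/
  fder : ℝ → ℝ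
  hf : ∀ i, ∀ x ∈ ⋃ j, Isub j, f (g i x) = x
  hfder : ∀ i, ∀ x ∈ ⋃ j, Isub j, fder (g i x) = (gder i x)⁻¹
  /-- the generator (expansivity) condition: `d_n → 0` -/
  hgen : ∀ ε : ℝ, 0 < ε → ∃ N : ℕ, ∀ w : List (Fin p), N ≤ w.length →
    Metric.diam (cylOf I Isub g w) < ε
  /-- the finite set of forbidden words -/
  Q : Finset (List (Fin p))
  /-- `Σ_Q` is completely invariant: `σ(Σ_Q) = Σ_Q` -/
  hQinv : ∀ ω : ℕ → Fin p, avoids Q ω →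
    ∃ ω' : ℕ → Fin p, avoids Q ω' ∧ ∀ n : ℕ, ω' (n + 1) = ω n
  /-- `f|Λ_Q` is topologically transitive -/
  htrans : ∀ U V : Set ℝ, IsOpen U → IsOpen V →
    (U ∩ limitSetOf I Isub g Q).Nonempty → (V ∩ limitSetOf I Isub g Q).Nonempty →
    ∃ n : ℕ, ∃ x ∈ U ∩ limitSetOf I Isub g Q, f^[n] x ∈ V

namespace ExpansiveMarkovSystem

variable {p : ℕ} (S : ExpansiveMarkovSystem p)

/-- The common domain `⋃ j, I_j` of the maps `g i`. -/
def dom : Set ℝ := ⋃ j, S.Isub j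

/-- The cylinder `Δ_w` associated to the word `w`. -/
def cyl (w : List (Fin p)) : Set ℝ := cylOf S.I S.Isub S.g w

/-- The limit set `Λ_Q`. -/
def limitSet : Set ℝ := limitSetOf S.I S.Isub S.g S.Q

/-- The domain of `f`, i.e. the union of the ranges of the `g i`. -/
def domF : Set ℝ := ⋃ i, S.g i '' S.dom

/-- The derivative `(fⁿ)'(x)` of the `n`-th iterate of `f` at `x`. -/
noncomputable def derIter (n : ℕ) (x : ℝ) : ℝ :=
  ∏ k ∈ Finset.range n, S.fder (S.f^[k] x)

/-- The Lyapunov exponent `χ(x) = limsup (1/n) log |(fⁿ)'(x)|`. -/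
noncomputable def lyap (x : ℝ) : ℝ :=
  Filter.limsup (fun n : ℕ => Real.log |S.derIter n x| / n) Filter.atTop

/-- The set `H` of points of `Λ_Q` with infinitely many hyperbolic instants. -/
def hypSet : Set ℝ :=
  { x ∈ S.limitSet | ∃ c₁ : ℝ, 0 < c₁ ∧ ∃ c₂ : ℝ, 0 < c₂ ∧
      ∃ n : ℕ → ℕ, StrictMono n ∧
        ∃ r : ℕ → ℝ, (∀ k, 0 < r k) ∧ Antitone r ∧
          Filter.Tendsto r Filter.atTop (nhds 0) ∧
          ∀ k : ℕ,
            (∀ y ∈ Metric.ball x (r k), ∀ j < n k, S.f^[j] y ∈ S.domF) ∧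
            c₁ < Metric.diam (S.f^[n k] '' Metric.ball x (r k)) ∧
            (∀ y ∈ Metric.ball x (r k), ∀ z ∈ Metric.ball x (r k),
              |S.derIter (n k) y| / |S.derIter (n k) z| < c₂) }

/-- `x` is a parabolic periodic point: `f^m(x) = x` and `|(f^m)'(x)| = 1`. -/
def IsParabolicPeriodic (x : ℝ) : Prop :=
  x ∈ S.limitSet ∧ ∃ m : ℕ, 1 ≤ m ∧ S.f^[m] x = x ∧ |S.derIter m x| = 1

/-- `ν` is a `t`-conformal (Borel probability) measure supported on `Λ_Q`. -/
def IsConformal (ν : Measure ℝ) (t : ℝ) : Prop :=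
  IsProbabilityMeasure ν ∧ ν S.limitSetᶜ = 0 ∧
    ∀ A : Set ℝ, MeasurableSet A → A ⊆ S.limitSet → Set.InjOn S.f A →
      ν (S.f '' A) = ∫⁻ x in A, ENNReal.ofReal (|S.fder x| ^ t) ∂ν

/-- `t_c = inf {t ≥ 0 : a t-conformal measure on Λ_Q exists}`. -/
noncomputable def tc : ℝ :=
  sInf { t : ℝ | 0 ≤ t ∧ ∃ ν : Measure ℝ, S.IsConformal ν t }

/-- `n` is a hyperbolic time for `x` with exponent `α`. -/
def IsHypTime (α : ℝ) (x : ℝ) (n : ℕ) : Prop :=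
  ∀ k : ℕ, 1 ≤ k → k ≤ n → Real.exp (k * α) ≤ |S.derIter k (S.f^[n - k] x)|

/-- `H_HT(α)`: the points of `Λ_Q` with infinitely many hyperbolic times with exponent `α`. -/
def HHT (α : ℝ) : Set ℝ :=
  { x ∈ S.limitSet | ∀ N : ℕ, ∃ n : ℕ, N ≤ n ∧ S.IsHypTime α x n }

end ExpansiveMarkovSystem

theorem Continuous.birkhoffSum {X : Type*} [TopologicalSpace X] {T : X → X} {φ : X → ℝ}
    (hT : Continuous T) (hφ : Continuous φ) (n : ℕ) : Continuous (birkhoffSum T φ n) :=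
  continuous_finsetSum _ fun i _ => hφ.comp (hT.iterate i)

/-- If some Birkhoff sum is positive at every point of a compact space, then the Birkhoff sums
grow uniformly linearly. -/
theorem exists_linear_le_birkhoffSum {X : Type*} [TopologicalSpace X] [CompactSpace X]
    {T : X → X} {φ : X → ℝ} (hT : Continuous T) (hφ : Continuous φ)
    (h : ∀ x, ∃ n, 0 < birkhoffSum T φ n x) :
    ∃ c > 0, ∃ C, ∀ n x, c * n - C ≤ birkhoffSum T φ n x := by
  obtain ⟨k, hk⟩ : ∃ k : ℕ, ∀ x, ∃ n ≤ k, (n : ℝ) / (k + 1) < birkhoffSum T φ n x := by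
    let U : ℕ → Set X := fun k => ⋃ n ∈ Finset.range (k + 1),
      {x | (n : ℝ) / (k + 1) < birkhoffSum T φ n x}
    have hU : ∀ k, IsOpen (U k) := fun k => isOpen_biUnion fun n _ =>
      isOpen_lt continuous_const (hT.birkhoffSum hφ n)
    have hmono : Monotone U := by
      intro k l hkl x hx
      simp only [U, mem_iUnion, Finset.mem_range, mem_ofPred_eq, exists_prop] at hx ⊢
      obtain ⟨n, hn, hx⟩ := hx
      refine ⟨n, by omega, lt_of_le_of_lt ?_ hx⟩
      gcongr
    obtain ⟨k, hk⟩ := isCompact_univ.elim_directed_cover U hU (fun x _ => by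
      obtain ⟨n, hn⟩ := h x
      obtain ⟨k, hk⟩ := exists_nat_gt (n / birkhoffSum T φ n x)
      rw [div_lt_iff₀ hn] at hk
      simp only [U, mem_iUnion, Finset.mem_range, mem_ofPred_eq, exists_prop]
      refine ⟨max k n, n, by omega, ?_⟩
      rw [div_lt_iff₀ (by positivity), mul_comm]
      refine hk.trans_le (mul_le_mul_of_nonneg_right ?_ hn.le)
      have : (k : ℝ) ≤ (max k n : ℕ) := by exact_mod_cast le_max_left k n
      linarith) hmono.directed_le
    refine ⟨k, fun x => ?_⟩
    have hx := hk (mem_univ x)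
    simp only [U, mem_iUnion, Finset.mem_range, mem_ofPred_eq, exists_prop] at hx
    obtain ⟨n, hn, hx⟩ := hx
    exact ⟨n, by omega, hx⟩
  obtain ⟨M, hM⟩ := isCompact_univ.exists_bound_of_continuousOn hφ.continuousOn
  have hM0 : ∀ x, -|M| ≤ φ x := fun x =>
    (abs_le.1 ((hM x (mem_univ x)).trans (le_abs_self M))).1
  have hc : (0 : ℝ) < 1 / (k + 1) := by positivity
  refine ⟨1 / (k + 1), hc, k * (1 / (k + 1) + |M|), fun n => ?_⟩
  induction n using Nat.strong_induction_on with
  | _ n ih =>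
    intro x
    obtain hn | hn := le_or_gt n k
    · have h1 : -((n : ℝ) * |M|) ≤ birkhoffSum T φ n x := by
        have := Finset.card_nsmul_le_sum (Finset.range n) (fun i => φ (T^[i] x)) (-|M|)
          fun i _ => hM0 _
        simpa [birkhoffSum, nsmul_eq_mul] using this
      have h2 : (n : ℝ) ≤ k := by exact_mod_cast hn
      nlinarith [abs_nonneg M]
    · obtain ⟨m, hm, hx⟩ := hk x
      have hm0 : m ≠ 0 := by
        rintro rfl
        simp at hx
      have h1 := ih (n - m) (by omega) (T^[m] x)
      have h2 : n = m + (n - m) := by omega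
      rw [h2, birkhoffSum_add]
      rw [← one_div_mul_eq_div] at hx
      push_cast
      linarith

/-- In a compact system, if the Birkhoff sums are nonpositive along some orbit, there is such
an orbit along which the observable `h` approaches its supremum infinitely often. -/
theorem exists_recurrent_of_birkhoffSum_nonpos {X : Type*} [TopologicalSpace X] [CompactSpace X]
    {T : X → X} {φ h : X → ℝ} (hT : Continuous T) (hφ : Continuous φ) (hh : Continuous h)
    (hne : ∃ x, ∀ n, birkhoffSum T φ n x ≤ 0) :
    ∃ x z : X, (∀ n, birkhoffSum T φ n x ≤ 0) ∧ (∀ n, h (T^[n] x) ≤ h z) ∧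
      (∀ n, h (T^[n] z) ≤ h z) ∧ ∀ ε > 0, ∃ᶠ n in atTop, h z - ε < h (T^[n] x) := by
  let E : Set X := {x | ∀ n, birkhoffSum T φ n x ≤ 0}
  have hE : IsClosed E := by
    simp only [E, ← iInter_ofPred]
    exact isClosed_iInter fun n => isClosed_le (hT.birkhoffSum hφ n) continuous_const
  obtain ⟨M, hM⟩ := (isCompact_range hh).bddAbove
  have hbdd : ∀ x, BddAbove (range fun n => h (T^[n] x)) := fun x =>
    ⟨M, by rintro _ ⟨n, rfl⟩; exact hM (mem_range_self _)⟩
  have hlsc : LowerSemicontinuous fun x => ⨆ n, h (T^[n] x) :=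
    lowerSemicontinuous_ciSup hbdd fun n => (hh.comp (hT.iterate n)).lowerSemicontinuous
  obtain ⟨x, hxE, hx⟩ := (hlsc.lowerSemicontinuousOn E).exists_isMinOn (s := E) hne hE.isCompact
  have hrec : ∀ ε > 0, ∃ᶠ n in atTop, (⨆ n, h (T^[n] x)) - ε < h (T^[n] x) := by
    intro ε hε hev
    simp only [not_lt] at hev
    obtain ⟨N, hN⟩ := eventually_atTop.1 hev
    let s : ℕ → ℝ := fun n => birkhoffSum T φ n x
    have hs : ∀ k, ∃ n ≥ k, ∀ m ≥ k, s m ≤ s n + 1 / (k + 1) := by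
      intro k
      have hb : BddAbove (s '' Ici k) := ⟨0, by rintro _ ⟨n, -, rfl⟩; exact hxE n⟩
      obtain ⟨_, ⟨n, hn, rfl⟩, hlt⟩ := exists_lt_of_lt_csSup
        (s := s '' Ici k) ⟨s k, k, le_refl k, rfl⟩
        (sub_lt_self (sSup (s '' Ici k)) (Nat.one_div_pos_of_nat (α := ℝ) (n := k)))
      refine ⟨n, hn, fun m hm => ?_⟩
      have := le_csSup hb (mem_image_of_mem s (show m ∈ Ici k from hm))
      linarith
    choose r hrk hr using hs
    obtain ⟨y, hy⟩ := exists_clusterPt_of_compactSpace (map (fun k => T^[r k] x) atTop)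
    have hclosed : ∀ F : Set X, IsClosed F → (∀ᶠ k in atTop, T^[r k] x ∈ F) → y ∈ F :=
      fun F hF hev => isClosed_iff_clusterPt.1 hF y (hy.mono (le_principal_iff.2 hev))
    have hyE : y ∈ E := by
      intro m
      refine le_of_forall_pos_le_add fun δ hδ => ?_
      refine hclosed {z | birkhoffSum T φ m z ≤ 0 + δ}
        (isClosed_le (hT.birkhoffSum hφ m) continuous_const) ?_
      filter_upwards [(tendsto_one_div_add_atTop_nhds_zero_nat (𝕜 := ℝ)).eventually_lt_const hδ]
        with k hk
      have h1 := hr k (r k + m) (by have := hrk k; omega)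
      have h2 : s (r k + m) = s (r k) + birkhoffSum T φ m (T^[r k] x) := birkhoffSum_add ..
      change birkhoffSum T φ m (T^[r k] x) ≤ 0 + δ
      linarith
    have hyh : ∀ m, h (T^[m] y) ≤ (⨆ n, h (T^[n] x)) - ε := by
      intro m
      refine hclosed {z | h (T^[m] z) ≤ (⨆ n, h (T^[n] x)) - ε}
        (isClosed_le (hh.comp (hT.iterate m)) continuous_const) ?_
      filter_upwards [eventually_ge_atTop N] with k hk
      rw [← Function.iterate_add_apply]
      exact hN _ (by have := hrk k; omega)
    have h1 := hx hyE
    have h2 : (⨆ n, h (T^[n] y)) ≤ (⨆ n, h (T^[n] x)) - ε := ciSup_le hyh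
    simp only [mem_ofPred_eq] at h1
    linarith
  let K : Set X := closure (range fun n => T^[n] x)
  obtain ⟨z, hzK, hz⟩ := (isClosed_closure.isCompact : IsCompact K).exists_isMaxOn
    ⟨x, subset_closure ⟨0, rfl⟩⟩ hh.continuousOn
  have hzx : ∀ n, h (T^[n] x) ≤ h z := fun n => hz (subset_closure ⟨n, rfl⟩)
  have hsup : h z ≤ ⨆ n, h (T^[n] x) := by
    refine closure_minimal ?_ (isClosed_le hh continuous_const) hzK
    rintro _ ⟨n, rfl⟩
    exact le_ciSup (hbdd x) n
  refine ⟨x, z, hxE, hzx, fun n => hz ?_, fun ε hε => (hrec ε hε).mono fun n hn => by linarith⟩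
  have hmap : MapsTo T^[n] K K := MapsTo.closure (by
    rintro _ ⟨m, rfl⟩
    exact ⟨n + m, Function.iterate_add_apply ..⟩) (hT.iterate n)
  exact hmap hzK

namespace ExpansiveMarkovSystem

variable {p : ℕ} (S : ExpansiveMarkovSystem p)

/-- The inverse branch `g_u = g_{i₁} ∘ ⋯ ∘ g_{iₙ}` associated with the word `u = [i₁, …, iₙ]`. -/
def branch : List (Fin p) → ℝ → ℝ
  | [], x => x
  | i :: u, x => S.g i (branch u x)

/-- The derivative of `S.branch u`, given by the chain rule. -/
noncomputable def branchDer : List (Fin p) → ℝ → ℝ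
  | [], _ => 1
  | i :: u, x => S.gder i (S.branch u x) * branchDer u x

variable {S}

lemma Isub_subset_dom (i : Fin p) : S.Isub i ⊆ S.dom := subset_iUnion S.Isub i

lemma ordConnected_Isub (i : Fin p) : (S.Isub i).OrdConnected := by
  obtain ⟨a, b, -, h⟩ := S.hIsub i
  rw [h]
  exact ordConnected_Icc

lemma Icc_subset_dom {j : Fin p} {s t : ℝ} (hs : s ∈ S.Isub j) (ht : t ∈ S.Isub j) :
    Icc s t ⊆ S.dom :=
  ((ordConnected_Isub j).out hs ht).trans (Isub_subset_dom j)

lemma g_mem_interior (i : Fin p) {x : ℝ} (hx : x ∈ S.dom) : S.g i x ∈ interior (S.Isub i) :=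
  S.hg_range i (mem_image_of_mem _ hx)

lemma g_mem (i : Fin p) {x : ℝ} (hx : x ∈ S.dom) : S.g i x ∈ S.Isub i :=
  interior_subset (g_mem_interior i hx)

lemma eq_of_mem_Isub {i j : Fin p} {x : ℝ} (hi : x ∈ S.Isub i) (hj : x ∈ S.Isub j) : i = j := by
  by_contra h
  exact disjoint_left.1 (S.hdisj i j h) hi hj

lemma branch_mem_dom (u : List (Fin p)) {x : ℝ} (hx : x ∈ S.dom) : S.branch u x ∈ S.dom := by
  induction u with
  | nil => exact hx
  | cons i u ih => exact Isub_subset_dom i (g_mem i ih)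

lemma branch_append (u v : List (Fin p)) (x : ℝ) :
    S.branch (u ++ v) x = S.branch u (S.branch v x) := by
  induction u with
  | nil => rfl
  | cons i u ih => simp [branch, ih]

lemma branchDer_append (u v : List (Fin p)) (x : ℝ) :
    S.branchDer (u ++ v) x = S.branchDer u (S.branch v x) * S.branchDer v x := by
  induction u with
  | nil => simp [branchDer]
  | cons i u ih => simp [branchDer, branch_append, ih, mul_assoc]

lemma branchDer_ne_zero (u : List (Fin p)) {x : ℝ} (hx : x ∈ S.dom) : S.branchDer u x ≠ 0 := by
  induction u with
  | nil => exact one_ne_zero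
  | cons i u ih => exact mul_ne_zero (S.hgder_ne i _ (branch_mem_dom u hx)) ih

lemma hasDerivWithinAt_branch (u : List (Fin p)) {x : ℝ} (hx : x ∈ S.dom) :
    HasDerivWithinAt (S.branch u) (S.branchDer u x) S.dom x := by
  induction u with
  | nil => exact hasDerivWithinAt_id x _
  | cons i u ih =>
    exact HasDerivWithinAt.comp x (S.hg_deriv i _ (branch_mem_dom u hx)) ih
      fun y hy => branch_mem_dom u hy

lemma continuousOn_branch (u : List (Fin p)) : ContinuousOn (S.branch u) S.dom :=
  fun _ hx => (hasDerivWithinAt_branch u hx).continuousWithinAt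

lemma injOn_branch (u : List (Fin p)) : InjOn (S.branch u) S.dom := by
  induction u with
  | nil => exact injOn_id _
  | cons i u ih => exact (S.hg_inj i).comp ih fun y hy => branch_mem_dom u hy

/-- A point determines the letters of the inverse branches through which it is reached. -/
lemma exists_append_of_branch_eq {u v : List (Fin p)} (h : v.length ≤ u.length) {s t : ℝ}
    (hs : s ∈ S.dom) (ht : t ∈ S.dom) (hst : S.branch u s = S.branch v t) :
    ∃ w, u = v ++ w ∧ t = S.branch w s := by
  induction v generalizing u with
  | nil => exact ⟨u, rfl, hst.symm⟩
  | cons i v ih =>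
    cases u with
    | nil => simp at h
    | cons k u =>
      have hu := branch_mem_dom u hs
      have hv := branch_mem_dom v ht
      obtain rfl : k = i := eq_of_mem_Isub (g_mem k hu) (by
        change S.branch (k :: u) s ∈ _
        rw [hst]
        exact g_mem i hv)
      obtain ⟨w, rfl, hw⟩ := ih (by simpa using h) (S.hg_inj k hu hv hst)
      exact ⟨w, rfl, hw⟩

lemma cyl_cons_subset (i : Fin p) (w : List (Fin p)) : S.cyl (i :: w) ⊆ S.Isub i := by
  induction w generalizing i with
  | nil => exact subset_rfl
  | cons j w ih =>
    rintro _ ⟨x, hx, rfl⟩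
    exact g_mem i (Isub_subset_dom j (ih j hx))

lemma cyl_subset_I (w : List (Fin p)) : S.cyl w ⊆ S.I := by
  cases w with
  | nil => exact subset_rfl
  | cons i w => exact (cyl_cons_subset i w).trans (S.hsubI i)

lemma isBounded_cyl (w : List (Fin p)) : Bornology.IsBounded (S.cyl w) := by
  obtain ⟨a, b, -, h⟩ := S.hI
  exact (h ▸ isBounded_Icc a b : Bornology.IsBounded S.I).subset (cyl_subset_I w)

lemma isCompact_cyl (w : List (Fin p)) : IsCompact (S.cyl w) := by
  induction w with
  | nil =>
    obtain ⟨a, b, -, h⟩ := S.hI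
    change IsCompact S.I
    exact h ▸ isCompact_Icc
  | cons i w ih =>
    cases w with
    | nil =>
      obtain ⟨a, b, -, h⟩ := S.hIsub i
      change IsCompact (S.Isub i)
      exact h ▸ isCompact_Icc
    | cons j w =>
      exact ih.image_of_continuousOn ((continuousOn_branch [i]).mono
        ((cyl_cons_subset j w).trans (Isub_subset_dom j)))

lemma cyl_nonempty (w : List (Fin p)) : (S.cyl w).Nonempty := by
  induction w with
  | nil =>
    obtain ⟨a, b, hab, h⟩ := S.hI
    exact ⟨a, by change a ∈ S.I; rw [h]; exact left_mem_Icc.2 hab.le⟩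
  | cons i w ih =>
    cases w with
    | nil =>
      obtain ⟨a, b, hab, h⟩ := S.hIsub i
      exact ⟨a, by change a ∈ S.Isub i; rw [h]; exact left_mem_Icc.2 hab.le⟩
    | cons j w => exact ih.image _

lemma cyl_append_subset (u v : List (Fin p)) : S.cyl (u ++ v) ⊆ S.cyl u := by
  induction u with
  | nil => exact cyl_subset_I v
  | cons i u ih =>
    cases u with
    | nil => exact cyl_cons_subset i v
    | cons j u => exact image_mono ih

lemma branch_mem_cyl (u : List (Fin p)) {j : Fin p} {x : ℝ} (hx : x ∈ S.Isub j) :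
    S.branch u x ∈ S.cyl (u ++ [j]) := by
  induction u with
  | nil => exact hx
  | cons i u ih =>
    cases u with
    | nil => exact mem_image_of_mem _ hx
    | cons k u => exact mem_image_of_mem _ ih

lemma eq_of_forall_mem_cyl {ω : ℕ → Fin p} {x y : ℝ} (hx : ∀ n, x ∈ S.cyl (wordOf ω n))
    (hy : ∀ n, y ∈ S.cyl (wordOf ω n)) : x = y := by
  refine dist_le_zero.1 (le_of_forall_pos_le_add fun ε hε => ?_)
  obtain ⟨N, hN⟩ := S.hgen ε hε
  have h := hN (wordOf ω N) (by simp [wordOf])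
  have := dist_le_diam_of_mem (isBounded_cyl (wordOf ω N)) (hx N) (hy N)
  rw [zero_add]
  exact this.trans h.le

/-- The inverse branches contract uniformly as the length of the word grows. -/
lemma exists_branch_contract {ε : ℝ} (hε : 0 < ε) : ∃ N : ℕ, ∀ u : List (Fin p), N ≤ u.length →
    ∀ j, ∀ s ∈ S.Isub j, ∀ t ∈ S.Isub j, |S.branch u s - S.branch u t| < ε := by
  obtain ⟨N, hN⟩ := S.hgen ε hε
  refine ⟨N, fun u hu j s hs t ht => ?_⟩
  rw [← Real.dist_eq]
  exact (dist_le_diam_of_mem (isBounded_cyl _) (branch_mem_cyl u hs) (branch_mem_cyl u ht)).trans_lt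
    (hN (u ++ [j]) (by simp; omega))

/-- No inverse branch along a nonempty word maps an interval over itself. -/
lemma not_Icc_subset_image_branch {u : List (Fin p)} (hu : u ≠ []) {j : Fin p} {s t : ℝ}
    (hs : s ∈ S.Isub j) (ht : t ∈ S.Isub j) (hst : s < t) :
    ¬ Icc s t ⊆ S.branch u '' Icc s t := by
  intro h
  obtain ⟨N, hN⟩ := exists_branch_contract (S := S) (sub_pos.2 hst)
  have hpow : ∀ k : ℕ, ∃ v : List (Fin p), k ≤ v.length ∧ Icc s t ⊆ S.branch v '' Icc s t := by
    intro k
    induction k with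
    | zero => exact ⟨[], le_rfl, fun x hx => ⟨x, hx, rfl⟩⟩
    | succ k ih =>
      obtain ⟨v, hv, hsub⟩ := ih
      refine ⟨u ++ v, ?_, fun x hx => ?_⟩
      · have := List.length_pos_iff.2 hu
        rw [List.length_append]
        omega
      · obtain ⟨y, hy, rfl⟩ := h hx
        obtain ⟨z, hz, rfl⟩ := hsub hy
        exact ⟨z, hz, branch_append u v z⟩
  obtain ⟨v, hv, hsub⟩ := hpow N
  obtain ⟨x, hx, hxs⟩ := hsub (left_mem_Icc.2 hst.le)
  obtain ⟨y, hy, hyt⟩ := hsub (right_mem_Icc.2 hst.le)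
  have hmem := (ordConnected_Isub j).out hs ht
  have := hN v hv j y (hmem hy) x (hmem hx)
  rw [hxs, hyt, abs_of_pos (sub_pos.2 hst)] at this
  exact this.false

lemma branch_mem_uIcc (u : List (Fin p)) {j : Fin p} {s t x : ℝ} (hs : s ∈ S.Isub j)
    (ht : t ∈ S.Isub j) (hx : x ∈ Icc s t) :
    S.branch u x ∈ uIcc (S.branch u s) (S.branch u t) := by
  have hst : s ≤ t := hx.1.trans hx.2
  have hsub := Icc_subset_dom hs ht
  have hl := left_mem_Icc.2 hst
  have hr := right_mem_Icc.2 hst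
  obtain h | h := ((continuousOn_branch u).mono hsub).strictMonoOn_of_injOn_Icc' hst
    ((injOn_branch u).mono hsub)
  · exact mem_uIcc_of_le (h.monotoneOn hl hx hx.1) (h.monotoneOn hx hr hx.2)
  · exact mem_uIcc_of_ge (h.antitoneOn hx hr hx.2) (h.antitoneOn hl hx hx.1)

lemma exists_branch_sub_eq (u : List (Fin p)) {j : Fin p} {s t : ℝ} (hs : s ∈ S.Isub j)
    (ht : t ∈ S.Isub j) (hst : s < t) :
    ∃ ξ ∈ Icc s t, S.branch u s - S.branch u t = S.branchDer u ξ * (s - t) := by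
  have hsub := Icc_subset_dom hs ht
  obtain ⟨ξ, hξ, h⟩ := exists_hasDerivAt_eq_slope (S.branch u) (S.branchDer u) hst
    ((continuousOn_branch u).mono hsub) fun x hx =>
      (hasDerivWithinAt_branch u (hsub (Ioo_subset_Icc_self hx))).hasDerivAt
        (mem_of_superset (Icc_mem_nhds hx.1 hx.2) hsub)
  refine ⟨ξ, Ioo_subset_Icc_self hξ, ?_⟩
  have : t - s ≠ 0 := (sub_pos.2 hst).ne'
  rw [h]
  field_simp
  ring

/-- The total length of the images of the interval with endpoints `s`, `t` under the inverse
branches along all proper suffixes of `u`. -/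
noncomputable def pullbackLength (S : ExpansiveMarkovSystem p) (u : List (Fin p)) (s t : ℝ) : ℝ :=
  ∑ k ∈ Finset.range u.length, |S.branch (u.drop (k + 1)) s - S.branch (u.drop (k + 1)) t|

lemma pullbackLength_cons (i : Fin p) (u : List (Fin p)) (s t : ℝ) :
    S.pullbackLength (i :: u) s t = S.pullbackLength u s t + |S.branch u s - S.branch u t| := by
  simp [pullbackLength, Finset.sum_range_succ']

/-- `θ` is a Lipschitz constant for all the functions `log |g i'|`. -/
def IsLogLipschitz (S : ExpansiveMarkovSystem p) (θ : ℝ) : Prop :=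
  0 ≤ θ ∧ ∀ i, ∀ x ∈ S.dom, ∀ y ∈ S.dom,
    |Real.log (S.gder i x) - Real.log (S.gder i y)| ≤ θ * |x - y|

lemma exists_isLogLipschitz (S : ExpansiveMarkovSystem p) : ∃ θ, S.IsLogLipschitz θ := by
  choose θ hθ using S.hgder_lip
  simp only [Real.log_abs] at hθ
  refine ⟨∑ i, |θ i|, Finset.sum_nonneg fun i _ => abs_nonneg _, fun i x hx y hy =>
    (hθ i x hx y hy).trans (mul_le_mul_of_nonneg_right ?_ (abs_nonneg _))⟩
  exact (le_abs_self _).trans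
    (Finset.single_le_sum (f := fun i => |θ i|) (fun i _ => abs_nonneg _) (Finset.mem_univ i))

/-- Distortion estimate for inverse branches. -/
lemma abs_log_branchDer_sub_le {θ : ℝ} (hθ : S.IsLogLipschitz θ) (u : List (Fin p)) {j : Fin p}
    {s t x y : ℝ} (hs : s ∈ S.Isub j) (ht : t ∈ S.Isub j) (hx : x ∈ Icc s t) (hy : y ∈ Icc s t) :
    |Real.log (S.branchDer u x) - Real.log (S.branchDer u y)| ≤ θ * S.pullbackLength u s t := by
  have hxd := Icc_subset_dom hs ht hx
  have hyd := Icc_subset_dom hs ht hy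
  induction u with
  | nil => simp [branchDer, pullbackLength]
  | cons i u ih =>
    rw [branchDer, branchDer,
      Real.log_mul (S.hgder_ne i _ (branch_mem_dom u hxd)) (branchDer_ne_zero u hxd),
      Real.log_mul (S.hgder_ne i _ (branch_mem_dom u hyd)) (branchDer_ne_zero u hyd),
      pullbackLength_cons, mul_add, add_sub_add_comm, add_comm (θ * _)]
    refine (abs_add_le _ _).trans (add_le_add ?_ ih)
    refine (hθ.2 i _ (branch_mem_dom u hxd) _ (branch_mem_dom u hyd)).trans
      (mul_le_mul_of_nonneg_left ?_ hθ.1)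
    have := abs_sub_le_of_uIcc_subset_uIcc
      (uIcc_subset_uIcc (branch_mem_uIcc u hs ht hx) (branch_mem_uIcc u hs ht hy))
    rwa [abs_sub_comm, abs_sub_comm (S.branch u t)] at this

lemma abs_branchDer_le {θ : ℝ} (hθ : S.IsLogLipschitz θ) (u : List (Fin p)) {j : Fin p}
    {s t x y : ℝ} (hs : s ∈ S.Isub j) (ht : t ∈ S.Isub j) (hx : x ∈ Icc s t) (hy : y ∈ Icc s t)
    {L : ℝ} (hL : S.pullbackLength u s t ≤ L) :
    |S.branchDer u x| ≤ Real.exp (θ * L) * |S.branchDer u y| := by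
  have hx0 := abs_pos.2 (branchDer_ne_zero u (Icc_subset_dom hs ht hx))
  have hy0 := abs_pos.2 (branchDer_ne_zero u (Icc_subset_dom hs ht hy))
  have h := (le_abs_self _).trans (abs_log_branchDer_sub_le hθ u hs ht hx hy)
  rw [← Real.log_abs, ← Real.log_abs (S.branchDer u y)] at h
  rw [← Real.log_le_log_iff hx0 (by positivity), Real.log_mul (Real.exp_ne_zero _) hy0.ne',
    Real.log_exp]
  linarith [mul_le_mul_of_nonneg_left hL hθ.1]

/-- If the pullbacks of `[a, b]` have bounded total length, so have those of a slightly larger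
interval `[y, b]`. -/
lemma pullbackLength_le_two_mul {θ L : ℝ} (hθ : S.IsLogLipschitz θ) (u : List (Fin p)) {j : Fin p}
    {y a b : ℝ} (hy : y ∈ S.Isub j) (hb : b ∈ S.Isub j) (hya : y < a) (hab : a < b)
    (hsmall : Real.exp (θ * (2 * L)) * (a - y) ≤ b - a) (hL : S.pullbackLength u a b ≤ L) :
    S.pullbackLength u y b ≤ 2 * S.pullbackLength u a b := by
  have ha : a ∈ S.Isub j := (ordConnected_Isub j).out hy hb ⟨hya.le, hab.le⟩
  induction u with
  | nil => simp [pullbackLength]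
  | cons i u ih =>
    rw [pullbackLength_cons] at hL
    have hLu : S.pullbackLength u a b ≤ L := by linarith [abs_nonneg (S.branch u a - S.branch u b)]
    have hyb := ih hLu
    obtain ⟨ξ, hξ, h1⟩ := exists_branch_sub_eq u hy ha hya
    obtain ⟨η, hη, h2⟩ := exists_branch_sub_eq u ha hb hab
    have hD := abs_branchDer_le hθ u hy hb (x := ξ) (y := η) ⟨hξ.1, hξ.2.trans hab.le⟩
      ⟨hya.le.trans hη.1, hη.2⟩ (hyb.trans (mul_le_mul_of_nonneg_left hLu zero_le_two))
    have h3 : |S.branch u y - S.branch u a| ≤ |S.branch u a - S.branch u b| := by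
      rw [h1, h2, abs_mul, abs_mul, abs_sub_comm y a, abs_sub_comm a b, abs_of_pos (sub_pos.2 hya),
        abs_of_pos (sub_pos.2 hab)]
      calc |S.branchDer u ξ| * (a - y)
          ≤ Real.exp (θ * (2 * L)) * |S.branchDer u η| * (a - y) :=
            mul_le_mul_of_nonneg_right hD (sub_pos.2 hya).le
        _ = |S.branchDer u η| * (Real.exp (θ * (2 * L)) * (a - y)) := by ring
        _ ≤ _ := mul_le_mul_of_nonneg_left hsmall (abs_nonneg _)
    rw [pullbackLength_cons, pullbackLength_cons]
    linarith [abs_sub_le (S.branch u y) (S.branch u a) (S.branch u b)]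

/-- Under the smallness condition of `pullbackLength_le_two_mul`, the derivative at `y` controls
the length of the image of `[a, b]`. -/
lemma abs_branchDer_mul_le {θ L : ℝ} (hθ : S.IsLogLipschitz θ) (u : List (Fin p)) {j : Fin p}
    {y a b : ℝ} (hy : y ∈ S.Isub j) (hb : b ∈ S.Isub j) (hya : y < a) (hab : a < b)
    (hsmall : Real.exp (θ * (2 * L)) * (a - y) ≤ b - a) (hL : S.pullbackLength u a b ≤ L) :
    |S.branchDer u y| * (b - a) ≤
      Real.exp (θ * (2 * L)) * |S.branch u a - S.branch u b| := by
  have ha : a ∈ S.Isub j := (ordConnected_Isub j).out hy hb ⟨hya.le, hab.le⟩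
  obtain ⟨η, hη, h⟩ := exists_branch_sub_eq u ha hb hab
  have hD := abs_branchDer_le hθ u hy hb (x := y) (y := η) ⟨le_rfl, (hya.trans hab).le⟩
    ⟨hya.le.trans hη.1, hη.2⟩
    ((pullbackLength_le_two_mul hθ u hy hb hya hab hsmall hL).trans
      (mul_le_mul_of_nonneg_left hL zero_le_two))
  rw [h, abs_mul, abs_sub_comm a, abs_of_pos (sub_pos.2 hab), ← mul_assoc]
  exact mul_le_mul_of_nonneg_right hD (sub_pos.2 hab).le

/-- If no inverse branch along a suffix of `u` maps `[a, b]` to an interval meeting `[a, b]`, then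
the pullbacks of `[a, b]` are disjoint and have total length at most the length of `I`. -/
lemma pullbackLength_le_of_disjoint (u : List (Fin p)) {j : Fin p} {a b : ℝ}
    (ha : a ∈ S.Isub j) (hb : b ∈ S.Isub j) (hab : a ≤ b)
    (hdisj : ∀ v, v <:+ u → v ≠ [] → ∀ s ∈ Icc a b, S.branch v s ∉ Icc a b) :
    S.pullbackLength u a b ≤ (volume S.I).toReal := by
  let J : ℕ → Set ℝ := fun k =>
    uIcc (S.branch (u.drop (k + 1)) a) (S.branch (u.drop (k + 1)) b)
  have hsub := Icc_subset_dom ha hb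
  have hJ : ∀ k, ∀ x ∈ J k, ∃ s ∈ Icc a b, S.branch (u.drop (k + 1)) s = x := by
    intro k x hx
    have hc := (continuousOn_branch (u.drop (k + 1))).mono hsub
    rw [← uIcc_of_le hab] at hc ⊢
    exact intermediate_value_uIcc hc hx
  have hlt : ∀ k < u.length, ∀ l < k, Disjoint (J l) (J k) := by
    intro k hk l hl
    refine disjoint_left.2 fun x hxl hxk => ?_
    obtain ⟨s, hs, rfl⟩ := hJ l x hxl
    obtain ⟨t, ht, hst⟩ := hJ k _ hxk
    obtain ⟨w, hw, rfl⟩ := exists_append_of_branch_eq (by simp; omega) (hsub hs) (hsub ht) hst.symm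
    refine hdisj w ?_ ?_ s hs ht
    · exact (List.suffix_append _ w).trans (hw ▸ List.drop_suffix (l + 1) u)
    · rintro rfl
      have := congrArg List.length hw
      simp at this
      omega
  have hpair : (Finset.range u.length : Set ℕ).PairwiseDisjoint J := by
    intro k hk l hl hkl
    simp only [Finset.coe_range, mem_Iio] at hk hl
    obtain h | h := lt_or_gt_of_ne hkl
    · exact hlt l hl k h
    · exact (hlt k hk l h).symm
  obtain ⟨A, B, -, hI⟩ := S.hI
  have hJI : ⋃ k ∈ Finset.range u.length, J k ⊆ S.I := by
    refine iUnion₂_subset fun k _ x hx => ?_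
    obtain ⟨s, hs, rfl⟩ := hJ k x hx
    exact cyl_subset_I _ (branch_mem_cyl _ ((ordConnected_Isub j).out ha hb hs))
  have hvol := measure_mono (μ := volume) hJI
  rw [measure_biUnion_finset hpair fun k _ => measurableSet_uIcc] at hvol
  have hfin : volume S.I ≠ ⊤ := by
    rw [hI]
    exact measure_Icc_lt_top.ne
  have := ENNReal.toReal_mono hfin hvol
  rw [ENNReal.toReal_sum fun k _ => by simp [J, Real.volume_interval]] at this
  simpa [J, pullbackLength, Real.volume_interval, abs_sub_comm] using this

/-- The left shift on sequences. -/
def shift (ω : ℕ → Fin p) : ℕ → Fin p := fun n => ω (n + 1)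

lemma iterate_shift (n : ℕ) (ω : ℕ → Fin p) (k : ℕ) : shift^[n] ω k = ω (k + n) := by
  induction n generalizing k with
  | zero => rfl
  | succ n ih =>
    rw [Function.iterate_succ_apply', shift, ih, Nat.add_right_comm, add_assoc]

lemma continuous_shift : Continuous (shift (p := p)) :=
  continuous_pi fun n => continuous_apply (n + 1)

lemma wordOf_succ' (ω : ℕ → Fin p) (n : ℕ) : wordOf ω (n + 1) = ω 0 :: wordOf (shift ω) n := by
  simp [wordOf, List.range_succ_eq_map, Function.comp_def, shift]

lemma wordOf_add (ω : ℕ → Fin p) (m n : ℕ) :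
    wordOf ω (m + n) = wordOf ω m ++ wordOf (shift^[m] ω) n := by
  simp [wordOf, List.range_add, Function.comp_def, iterate_shift, add_comm]

@[simp] lemma length_wordOf (ω : ℕ → Fin p) (n : ℕ) : (wordOf ω n).length = n := by
  simp [wordOf]

lemma eq_wordOf_of_suffix {ω : ℕ → Fin p} {n : ℕ} {v : List (Fin p)} (h : v <:+ wordOf ω n) :
    ∃ k, k + v.length = n ∧ v = wordOf (shift^[k] ω) v.length := by
  obtain ⟨w, hw⟩ := h
  have hlen := congrArg List.length hw
  rw [List.length_append, length_wordOf] at hlen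
  refine ⟨w.length, hlen, ?_⟩
  rw [← hlen, wordOf_add] at hw
  exact (List.append_inj hw (by simp)).2

lemma exists_forall_mem_cyl (S : ExpansiveMarkovSystem p) (ω : ℕ → Fin p) :
    ∃ x, ∀ n, x ∈ S.cyl (wordOf ω n) := by
  have := IsCompact.nonempty_iInter_of_sequence_nonempty_isCompact_isClosed
    (fun n => S.cyl (wordOf ω n)) (fun n => by
      rw [wordOf_add ω n 1]
      exact cyl_append_subset _ _) (fun n => cyl_nonempty _) (isCompact_cyl _)
    fun n => (isCompact_cyl _).isClosed
  simpa [Set.Nonempty] using this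

/-- The coding map `π`. -/
noncomputable def coding (S : ExpansiveMarkovSystem p) (ω : ℕ → Fin p) : ℝ :=
  (exists_forall_mem_cyl S ω).choose

lemma coding_mem_cyl (ω : ℕ → Fin p) (n : ℕ) : S.coding ω ∈ S.cyl (wordOf ω n) :=
  (exists_forall_mem_cyl S ω).choose_spec n

lemma coding_mem_Isub (ω : ℕ → Fin p) : S.coding ω ∈ S.Isub (ω 0) := coding_mem_cyl ω 1

lemma coding_mem_dom (ω : ℕ → Fin p) : S.coding ω ∈ S.dom :=
  Isub_subset_dom _ (coding_mem_Isub ω)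

lemma coding_eq_g (ω : ℕ → Fin p) : S.coding ω = S.g (ω 0) (S.coding (shift ω)) := by
  refine eq_of_forall_mem_cyl (coding_mem_cyl ω) fun n => ?_
  match n with
  | 0 => exact S.hsubI _ (g_mem (ω 0) (coding_mem_dom (shift ω)))
  | 1 => exact g_mem (ω 0) (coding_mem_dom (shift ω))
  | n + 2 =>
    have := coding_mem_cyl (S := S) (shift ω) (n + 1)
    rw [wordOf_succ'] at this
    rw [wordOf_succ', wordOf_succ']
    exact mem_image_of_mem _ this

lemma coding_mem_interior (ω : ℕ → Fin p) : S.coding ω ∈ interior (S.Isub (ω 0)) := by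
  rw [coding_eq_g]
  exact g_mem_interior (ω 0) (coding_mem_dom _)

lemma branch_wordOf_coding (ω : ℕ → Fin p) (n : ℕ) :
    S.branch (wordOf ω n) (S.coding (shift^[n] ω)) = S.coding ω := by
  induction n generalizing ω with
  | zero => rfl
  | succ n ih =>
    rw [wordOf_succ', branch, Function.iterate_succ_apply, ih, ← coding_eq_g]

lemma f_coding (ω : ℕ → Fin p) : S.f (S.coding ω) = S.coding (shift ω) := by
  rw [coding_eq_g, S.hf _ _ (coding_mem_dom _)]

lemma iterate_f_coding (n : ℕ) (ω : ℕ → Fin p) :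
    S.f^[n] (S.coding ω) = S.coding (shift^[n] ω) := by
  induction n with
  | zero => rfl
  | succ n ih => rw [Function.iterate_succ_apply', ih, f_coding, Function.iterate_succ_apply']

lemma fder_coding (ω : ℕ → Fin p) :
    S.fder (S.coding ω) = (S.gder (ω 0) (S.coding (shift ω)))⁻¹ := by
  rw [coding_eq_g, S.hfder _ _ (coding_mem_dom _)]

lemma fder_coding_ne_zero (ω : ℕ → Fin p) : S.fder (S.coding ω) ≠ 0 := by
  rw [fder_coding]
  exact inv_ne_zero (S.hgder_ne _ _ (coding_mem_dom _))

lemma continuous_coding : Continuous S.coding := by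
  refine continuous_iff_continuousAt.2 fun ω => Metric.tendsto_nhds.2 fun ε hε => ?_
  obtain ⟨N, hN⟩ := S.hgen ε hε
  have hev : ∀ᶠ ω' in nhds ω, ∀ k < N, ω' k = ω k := by
    refine (Finset.eventually_all (Finset.range N)).2 (fun k _ => ?_) |>.mono
      fun ω' h k hk => h k (Finset.mem_range.2 hk)
    exact (continuous_apply k).continuousAt.eventually_mem
      ((isOpen_discrete {ω k}).mem_nhds rfl)
  filter_upwards [hev] with ω' h
  have hw : wordOf ω' N = wordOf ω N := List.map_congr_left fun k hk => h k (List.mem_range.1 hk)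
  exact (dist_le_diam_of_mem (isBounded_cyl _) (hw ▸ coding_mem_cyl ω' N)
    (coding_mem_cyl ω N)).trans_lt (hN _ (by simp))

lemma continuous_log_fder_coding :
    Continuous fun ω : ℕ → Fin p => Real.log (S.fder (S.coding ω)) := by
  refine continuous_iff_continuousAt.2 fun ω => ?_
  have hc : Continuous fun ω' : ℕ → Fin p => -Real.log (S.gder (ω 0) (S.coding (shift ω'))) := by
    refine (Continuous.log ?_ fun ω' => S.hgder_ne _ _ (coding_mem_dom _)).neg
    exact (S.hgder_cont (ω 0)).comp_continuous (continuous_coding.comp continuous_shift)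
      fun ω' => coding_mem_dom _
  refine hc.continuousAt.congr ?_
  filter_upwards [(continuous_apply (0 : ℕ)).continuousAt.eventually_mem
    ((isOpen_discrete {ω 0}).mem_nhds rfl)] with ω' h
  rw [fder_coding, Real.log_inv, mem_singleton_iff.1 h]

/-- The Birkhoff sums of `log |f'|` in symbolic coordinates. -/
lemma log_derIter_coding (n : ℕ) (ω : ℕ → Fin p) :
    Real.log (S.derIter n (S.coding ω)) =
      birkhoffSum shift (fun ω => Real.log (S.fder (S.coding ω))) n ω := by
  simp only [derIter, birkhoffSum, iterate_f_coding]
  exact Real.log_prod fun k _ => fder_coding_ne_zero _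

lemma derIter_coding_ne_zero (n : ℕ) (ω : ℕ → Fin p) : S.derIter n (S.coding ω) ≠ 0 :=
  Finset.prod_ne_zero_iff.2 fun k _ => iterate_f_coding (S := S) k ω ▸ fder_coding_ne_zero _

lemma log_branchDer_wordOf (n : ℕ) (ω : ℕ → Fin p) :
    Real.log (S.branchDer (wordOf ω n) (S.coding (shift^[n] ω))) =
      -birkhoffSum shift (fun ω => Real.log (S.fder (S.coding ω))) n ω := by
  induction n generalizing ω with
  | zero => simp [wordOf, branchDer]
  | succ n ih =>
    rw [wordOf_succ', branchDer, Function.iterate_succ_apply, branch_wordOf_coding,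
      Real.log_mul (S.hgder_ne _ _ (coding_mem_dom _)) (branchDer_ne_zero _ (coding_mem_dom _)),
      ih, birkhoffSum_succ', fder_coding, Real.log_inv, neg_add, neg_neg]

lemma avoids_shift {Q : Finset (List (Fin p))} {ω : ℕ → Fin p} (h : avoids Q ω) :
    avoids Q (shift ω) := by
  intro w hw n hc
  refine h w hw (n + 1) fun k hk => ?_
  rw [Nat.add_right_comm]
  exact hc k hk

lemma isClosed_avoids (Q : Finset (List (Fin p))) : IsClosed {ω : ℕ → Fin p | avoids Q ω} := by
  simp only [avoids, ofPred_forall]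
  refine isClosed_iInter fun w => isClosed_iInter fun _ => isClosed_iInter fun n => ?_
  have h : IsOpen (⋂ k : Fin w.length, {ω : ℕ → Fin p | ω (n + k) = w.get k}) :=
    isOpen_iInter_of_finite fun k =>
      (isOpen_discrete ({w.get k} : Set (Fin p))).preimage
        (f := fun ω : ℕ → Fin p => ω (n + k)) (continuous_apply _)
  convert h.isClosed_compl using 1
  ext ω
  simp [containsAt, Fin.exists_iff]

lemma exists_coding_eq {x : ℝ} (hx : x ∈ S.limitSet) : ∃ ω, avoids S.Q ω ∧ S.coding ω = x := by
  obtain ⟨ω, hω, h⟩ := hx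
  exact ⟨ω, hω, eq_of_forall_mem_cyl (coding_mem_cyl ω) h⟩

lemma coding_mem_limitSet {ω : ℕ → Fin p} (h : avoids S.Q ω) : S.coding ω ∈ S.limitSet :=
  ⟨ω, h, coding_mem_cyl ω⟩

/-- In the absence of parabolic points, periodic points in `Λ_Q` are repelling. -/
lemma birkhoffSum_pos_of_periodic (hnopar : ∀ x, ¬ S.IsParabolicPeriodic x) {ω : ℕ → Fin p}
    (hω : avoids S.Q ω) {m : ℕ} (hm : 1 ≤ m) (hper : S.coding (shift^[m] ω) = S.coding ω) :
    0 < birkhoffSum shift (fun ω => Real.log (S.fder (S.coding ω))) m ω := by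
  by_contra! hle
  obtain h0 | hneg := hle.eq_or_lt
  · refine hnopar (S.coding ω) ⟨coding_mem_limitSet hω, m, hm,
      (iterate_f_coding m ω).trans hper, ?_⟩
    rw [← log_derIter_coding, ← Real.log_abs] at h0
    rw [← Real.exp_log (abs_pos.2 (derIter_coding_ne_zero m ω)), h0, Real.exp_zero]
  set a := S.coding ω
  set u := wordOf ω m
  have hfix : S.branch u a = a := by
    have := branch_wordOf_coding (S := S) ω m
    rwa [hper] at this
  have hfix2 : S.branch (u ++ u) a = a := by rw [branch_append, hfix, hfix]
  have hD : 1 < S.branchDer (u ++ u) a := by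
    have h1 := log_branchDer_wordOf (S := S) m ω
    rw [hper, ← Real.log_abs] at h1
    have h2 : 1 < |S.branchDer u a| :=
      (Real.log_pos_iff (abs_nonneg _)).1 (by rw [h1]; linarith)
    rw [branchDer_append, hfix, ← abs_mul_abs_self]
    nlinarith
  have hnhds : S.Isub (ω 0) ∈ nhds a := mem_interior_iff_mem_nhds.1 (coding_mem_interior ω)
  have hder : HasDerivAt (S.branch (u ++ u)) (S.branchDer (u ++ u) a) a :=
    (hasDerivWithinAt_branch _ (coding_mem_dom ω)).hasDerivAt
      (mem_of_superset hnhds (Isub_subset_dom _))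
  have hslope : ∀ᶠ b in nhdsWithin a (Ioi a), 1 < slope (S.branch (u ++ u)) a b :=
    ((hasDerivAt_iff_tendsto_slope.1 hder).eventually_const_lt hD).filter_mono
      (nhdsWithin_mono a fun b hb => ne_of_gt hb)
  obtain ⟨b, ⟨hb, hbI⟩, hab⟩ := ((hslope.and (mem_nhdsWithin_of_mem_nhds hnhds)).and
    self_mem_nhdsWithin).exists
  have hab : a < b := hab
  rw [slope_def_field, lt_div_iff₀ (sub_pos.2 hab), hfix2] at hb
  have huu : u ++ u ≠ [] := by
    intro h
    have := congrArg List.length h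
    simp [u] at this
    omega
  refine not_Icc_subset_image_branch huu (coding_mem_Isub ω) hbI hab ?_
  have hivt := intermediate_value_Icc hab.le ((continuousOn_branch (u ++ u)).mono
    (Icc_subset_dom (coding_mem_Isub ω) hbI))
  rw [hfix2] at hivt
  exact (Icc_subset_Icc_right (by linarith)).trans hivt

/-- In the absence of parabolic points, the orbit of a point with nonpositive Birkhoff sums does
not visit any point twice. -/
lemma coding_iterate_ne (hnopar : ∀ x, ¬ S.IsParabolicPeriodic x) {ω : ℕ → Fin p}
    (hω : avoids S.Q ω)
    (hS : ∀ n, birkhoffSum shift (fun ω => Real.log (S.fder (S.coding ω))) n ω ≤ 0)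
    {i j : ℕ} (hij : i < j) : S.coding (shift^[i] ω) ≠ S.coding (shift^[j] ω) := by
  intro heq
  obtain ⟨m, hm, rfl⟩ : ∃ m, 1 ≤ m ∧ j = m + i := ⟨j - i, by omega, by omega⟩
  set φ : (ℕ → Fin p) → ℝ := fun ω => Real.log (S.fder (S.coding ω))
  set ω' := shift^[i] ω with hω'
  have hav : avoids S.Q ω' :=
    Function.Iterate.rec (fun ω => avoids S.Q ω) hω (fun _ => avoids_shift) i
  rw [Function.iterate_add_apply, ← hω'] at heq
  have hpos : 0 < birkhoffSum shift φ m ω' := birkhoffSum_pos_of_periodic hnopar hav hm heq.symm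
  have hmul : ∀ k : ℕ, birkhoffSum shift φ (m * k) ω' = k * birkhoffSum shift φ m ω' := by
    intro k
    induction k with
    | zero => simp
    | succ k ih =>
      have hk : S.coding (shift^[m * k] ω') = S.coding ω' := by
        rw [← iterate_f_coding, Function.iterate_mul]
        exact Function.iterate_fixed (by rw [iterate_f_coding, heq]) k
      have hk' : birkhoffSum shift φ m (shift^[m * k] ω') = birkhoffSum shift φ m ω' :=
        (log_derIter_coding m _).symm.trans (by rw [hk]; exact log_derIter_coding m _)
      rw [mul_add_one, birkhoffSum_add, ih, hk']
      push_cast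
      ring
  obtain ⟨k, hk⟩ := exists_nat_gt (-birkhoffSum shift φ i ω / birkhoffSum shift φ m ω')
  rw [div_lt_iff₀ hpos, ← hmul k] at hk
  have := hS (i + m * k)
  rw [birkhoffSum_add] at this
  linarith

/-- An orbit with bounded derivatives cannot accumulate, from the left, at its supremum `π(α)`
without attaining it. -/
lemma not_frequently_lt_coding {ω α : ℕ → Fin p} {C : ℝ}
    (hS : ∀ n, birkhoffSum shift (fun ω => Real.log (S.fder (S.coding ω))) n ω ≤ C)
    (hlt : ∀ n, S.coding (shift^[n] ω) < S.coding α)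
    (hα : ∀ n, S.coding (shift^[n] α) ≤ S.coding α) :
    ¬ ∀ ε > 0, ∃ n, S.coding α - ε < S.coding (shift^[n] ω) := by
  intro hacc
  obtain ⟨θ, hθ⟩ := exists_isLogLipschitz S
  set a := S.coding α
  set L := (volume S.I).toReal
  set E := Real.exp (θ * (2 * L))
  have hE0 : 0 < E := Real.exp_pos _
  obtain ⟨δ, hδ, hball⟩ := Metric.nhds_basis_closedBall.mem_iff.1
    (mem_interior_iff_mem_nhds.1 (coding_mem_interior (S := S) α))
  rw [Real.closedBall_eq_Icc] at hball
  have hb : a + δ ∈ S.Isub (α 0) := hball ⟨by linarith, le_rfl⟩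
  have hab : a < a + δ := by linarith
  have ha : a ∈ S.Isub (α 0) := coding_mem_Isub α
  obtain ⟨N, hN⟩ := exists_branch_contract (S := S) (ε := Real.exp (-C) * δ / E) (by positivity)
  obtain ⟨c, ⟨hcN, hc⟩, hca⟩ : ∃ c, ((∀ k ∈ Finset.range N, S.coding (shift^[k] ω) < c) ∧
      max (a - δ) (a - δ / E) < c) ∧ c < a := by
    have hmax : max (a - δ) (a - δ / E) < a :=
      max_lt (by linarith) (sub_lt_self a (div_pos hδ hE0))
    exact ((((Finset.eventually_all _).2 fun k _ => mem_of_superset (Ioo_mem_nhdsLT (hlt k))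
      fun c hc => hc.1).and (mem_of_superset (Ioo_mem_nhdsLT hmax)
      fun c hc => hc.1)).and self_mem_nhdsWithin).exists
  obtain ⟨hcδ, hcE⟩ := max_lt_iff.1 hc
  have hex : ∃ n, c < S.coding (shift^[n] ω) := by
    obtain ⟨n, hn⟩ := hacc (a - c) (sub_pos.2 hca)
    exact ⟨n, by linarith⟩
  set n := Nat.find hex
  have hcn : c < S.coding (shift^[n] ω) := Nat.find_spec hex
  have hrec : ∀ k < n, S.coding (shift^[k] ω) < S.coding (shift^[n] ω) := fun k hk =>
    (not_lt.1 (Nat.find_min hex hk)).trans_lt hcn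
  have hNn : N ≤ n := by
    by_contra! h
    exact (hcN n (Finset.mem_range.2 h)).not_gt hcn
  set y := S.coding (shift^[n] ω)
  have hya : y < a := hlt n
  have hy : y ∈ S.Isub (α 0) := hball ⟨by linarith, by linarith⟩
  have hL : S.pullbackLength (wordOf ω n) a (a + δ) ≤ L := by
    refine pullbackLength_le_of_disjoint _ ha hb hab.le fun v hv hv0 s hs hvs => ?_
    obtain ⟨k, hk, hvk⟩ := eq_wordOf_of_suffix hv
    have hvy : S.branch v y < y := by
      have h := branch_wordOf_coding (S := S) (shift^[k] ω) v.length
      rw [← Function.iterate_add_apply, add_comm, hk, ← hvk] at h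
      rw [h]
      exact hrec k (by have := List.length_pos_iff.2 hv0; omega)
    have hva : a ≤ S.branch v a := by
      by_contra! hlta
      have hsI := (ordConnected_Isub _).out ha hb hs
      obtain ⟨t, ht, hta⟩ := intermediate_value_Icc hs.1
        ((continuousOn_branch v).mono (Icc_subset_dom ha hsI)) ⟨hlta.le, hvs.1⟩
      obtain ⟨w, hw, htw⟩ := exists_append_of_branch_eq (v := wordOf α v.length) (by simp)
        (Icc_subset_dom ha hsI ht) (coding_mem_dom (shift^[v.length] α))
        (hta.trans (branch_wordOf_coding α v.length).symm)
      have hw0 : w = [] := by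
        have := congrArg List.length hw
        simpa using this
      subst hw0
      have htw' : S.coding (shift^[v.length] α) = t := htw
      have hat : t = a := le_antisymm (htw' ▸ hα v.length) ht.1
      rw [hat] at hta
      exact hlta.ne hta
    exact not_Icc_subset_image_branch hv0 hy ha hya ((Icc_subset_Icc hvy.le hva).trans
      (intermediate_value_Icc hya.le ((continuousOn_branch v).mono (Icc_subset_dom hy ha))))
  have hsmall : E * (a - y) ≤ a + δ - a := by
    have : a - y ≤ δ / E := by linarith
    rw [le_div_iff₀ hE0] at this
    linarith
  have hmain := abs_branchDer_mul_le hθ (wordOf ω n) hy hb hya hab hsmall hL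
  have hDy : Real.exp (-C) ≤ |S.branchDer (wordOf ω n) y| := by
    rw [← Real.exp_log (abs_pos.2 (branchDer_ne_zero (wordOf ω n) (coding_mem_dom _))),
      Real.log_abs, log_branchDer_wordOf]
    exact Real.exp_le_exp.2 (neg_le_neg (hS n))
  have hcontr := hN (wordOf ω n) (by simpa using hNn) _ a ha _ hb
  rw [lt_div_iff₀ hE0, mul_comm _ E] at hcontr
  rw [add_sub_cancel_left] at hmain
  have := mul_le_mul_of_nonneg_right hDy hδ.le
  linarith

end ExpansiveMarkovSystem

open ExpansiveMarkovSystem in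
/-- If `f` has no parabolic periodic points in `Λ_Q`, then `f|Λ_Q` is
uniformly hyperbolic: there are `C > 0` and `κ > 1` with `|(fⁿ)'(x)| ≥ C κⁿ` for every
`x ∈ Λ_Q` and every `n ≥ 1`. -/
theorem uniformly_hyperbolic_of_no_parabolic {p : ℕ} (S : ExpansiveMarkovSystem p)
    (hnopar : ∀ x : ℝ, ¬ S.IsParabolicPeriodic x) :
    ∃ C : ℝ, 0 < C ∧ ∃ κ : ℝ, 1 < κ ∧
      ∀ x ∈ S.limitSet, ∀ n : ℕ, 1 ≤ n → C * κ ^ n ≤ |S.derIter n x| := by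
  let X : Set (ℕ → Fin p) := {ω | avoids S.Q ω}
  have : CompactSpace X := isCompact_iff_compactSpace.1 (isClosed_avoids S.Q).isCompact
  have hmaps : MapsTo shift X X := fun ω hω => avoids_shift hω
  let T : X → X := hmaps.restrict
  have hT : Continuous T := (continuous_shift.comp continuous_subtype_val).subtype_mk _
  have hTval : ∀ n (x : X), (T^[n] x : ℕ → Fin p) = shift^[n] x := fun n x =>
    (Function.Semiconj.iterate_right (f := Subtype.val) (fun _ => rfl) n) x
  let φ : (ℕ → Fin p) → ℝ := fun ω => Real.log (S.fder (S.coding ω))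
  have hφ : Continuous fun x : X => φ x := continuous_log_fder_coding.comp continuous_subtype_val
  have hsum : ∀ n (x : X), birkhoffSum T (fun x : X => φ x) n x = birkhoffSum shift φ n x :=
    fun n x => by simp [birkhoffSum, hTval]
  have hpos : ∀ x : X, ∃ n, 0 < birkhoffSum T (fun x : X => φ x) n x := by
    by_contra! hne
    obtain ⟨x, z, hx, hxz, hz, hfreq⟩ := exists_recurrent_of_birkhoffSum_nonpos hT hφ
      (continuous_coding.comp continuous_subtype_val : Continuous fun x : X => S.coding x) hne
    simp only [hsum, hTval, Function.comp_apply] at hx hxz hz hfreq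
    by_cases hev : ∃ N, ∀ n ≥ N, S.coding (shift^[n] x) < S.coding z
    · obtain ⟨N, hN⟩ := hev
      refine not_frequently_lt_coding (S := S) (ω := shift^[N] x) (α := z)
        (C := -birkhoffSum shift φ N x) (fun n => ?_) (fun n => ?_) hz fun ε hε => ?_
      · have := hx (N + n)
        rw [birkhoffSum_add] at this
        linarith
      · rw [← Function.iterate_add_apply]
        exact hN _ (by omega)
      · obtain ⟨n, hn, h⟩ := frequently_atTop.1 (hfreq ε hε) N
        refine ⟨n - N, ?_⟩
        rwa [← Function.iterate_add_apply, Nat.sub_add_cancel hn]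
    · push Not at hev
      obtain ⟨i, -, hi⟩ := hev 0
      obtain ⟨j, hj, hj'⟩ := hev (i + 1)
      exact coding_iterate_ne hnopar x.2 hx hj
        (((hxz i).antisymm hi).trans ((hxz j).antisymm hj').symm)
  obtain ⟨c, hc, C, h⟩ := exists_linear_le_birkhoffSum hT hφ hpos
  refine ⟨Real.exp (-C), Real.exp_pos _, Real.exp c, Real.one_lt_exp_iff.2 hc, fun x hx n _ => ?_⟩
  obtain ⟨ω, hω, rfl⟩ := exists_coding_eq hx
  have hn := h n ⟨ω, hω⟩
  rw [hsum] at hn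
  rw [← Real.exp_log (abs_pos.2 (derIter_coding_ne_zero n ω)), Real.log_abs, log_derIter_coding,
    ← Real.exp_nat_mul, ← Real.exp_add]
  exact Real.exp_le_exp.2 (by linarith)
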